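/- arXiv:2306.11196 — 12 statements merged into one kernel-verified Lean document; each statement's English description precedes it below -/
import Mathlib

section
/- Let (G,·,▷) be a post-group and define a ∘ b = a·(a ▷ b) for a,b ∈ G. Then (G,∘) is a group whose identity is the identity element e of (G,·), and the inverse of a in (G,∘) is a† = (L^▷_a)⁻¹(a⁻¹), where a⁻¹ is the inverse of a in (G,·). In particular a ▷ a† = a⁻¹ for all a ∈ G. -/
/-- In a post-group `(G, ·, ▷)`, the operation `a ∘ b = a · (a ▷ b)`
makes `G` into a group with identity `1` and inverse `a† = (L^▷_a)⁻¹ (a⁻¹)`;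
in particular `a ▷ a† = a⁻¹`. -/
theorem postGroup_subAdjacent_group {G : Type*} [Group G] (tri : G → G → G)
    (hbij : ∀ a : G, Function.Bijective (tri a))
    (hdist : ∀ a b c : G, tri a (b * c) = tri a b * tri a c)
    (hw : ∀ a b c : G, tri (a * tri a b) c = tri a (tri b c)) :
    let op : G → G → G := fun a b => a * tri a b
    let dag : G → G := fun a => (Equiv.ofBijective (tri a) (hbij a)).symm a⁻¹
    (∀ a b c : G, op (op a b) c = op a (op b c)) ∧
    (∀ a : G, op a 1 = a) ∧
    (∀ a : G, op 1 a = a) ∧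
    (∀ a : G, op a (dag a) = 1) ∧
    (∀ a : G, op (dag a) a = 1) ∧
    (∀ a : G, tri a (dag a) = a⁻¹) := by
  intro op dag
  have tri_one : ∀ a : G, tri a 1 = 1 := fun a => by simpa using hdist a 1 1
  have one_tri : ∀ c : G, tri 1 c = c := fun c =>
    (hbij 1).injective (by simpa [tri_one] using (hw 1 1 c).symm)
  have tri_dag : ∀ a : G, tri a (dag a) = a⁻¹ := fun a =>
    (Equiv.ofBijective (tri a) (hbij a)).apply_symm_apply a⁻¹
  refine ⟨fun a b c => ?_, fun a => ?_, fun a => ?_, fun a => ?_, fun a => ?_, tri_dag⟩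
  · simp only [op, hw, hdist, mul_assoc]
  · simp only [op, tri_one, mul_one]
  · simp only [op, one_tri, one_mul]
  · simp only [op, tri_dag, mul_inv_cancel]
  · apply (hbij a).injective
    simp only [op, hdist, ← hw, tri_dag, mul_inv_cancel, one_tri, inv_mul_cancel, tri_one]
end

section
/- Let (G,·_G) and (H,·_H) be groups, Φ : G → Aut(H) an action, and B : H → G a relative Rota-Baxter operator on (G,·_G) with respect to Φ. Define h ▷ k = Φ(B(h))(k) for h,k ∈ H. Then (H,·_H,▷) is a post-group, and its sub-adjacent group operation h ·_H (h ▷ k) coincides with the descendant operation h ∘_H k = h ·_H Φ(B(h))(k). -/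
/-- If `B : H → G` is a relative Rota-Baxter operator on `(G, ·_G)`
with respect to an action `Φ : G → Aut(H)`, then `h ▷ k := Φ(B h)(k)` makes
`(H, ·_H, ▷)` a post-group, whose sub-adjacent operation `h ·_H (h ▷ k)`
coincides with the descendant operation `h ∘_H k = h ·_H Φ(B h)(k)`. -/
theorem relativeRotaBaxter_to_postGroup {G H : Type*} [Group G] [Group H]
    (Φ : G →* MulAut H) (B : H → G)
    (hB : ∀ h k : H, B h * B k = B (h * Φ (B h) k)) :
    let tri : H → H → H := fun h k => Φ (B h) k
    (∀ h : H, Function.Bijective (tri h)) ∧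
    (∀ h k l : H, tri h (k * l) = tri h k * tri h l) ∧
    (∀ h k l : H, tri (h * tri h k) l = tri h (tri k l)) ∧
    (∀ h k : H, h * tri h k = h * Φ (B h) k) := by
  refine ⟨fun h => (Φ (B h)).bijective, fun h k l => map_mul (Φ (B h)) k l, fun h k l => ?_,
    fun _ _ => rfl⟩
  change Φ (B (h * Φ (B h) k)) l = Φ (B h) (Φ (B k) l)
  rw [← hB, map_mul, MulAut.mul_apply]
end

section
/- Let (G,·_G) and (H,·_H) be groups, Φ : G → Aut(H) an action, and B : H → G an arbitrary map. Let ξ_B : H × G → H ⋊_Φ G be the bijection ξ_B(h,a) = (h, B(h) ·_G a), and let ∗ be the group multiplication on H × G transported from the semidirect product along ξ_B, i.e. (h,a) ∗ (k,b) = ξ_B⁻¹(ξ_B(h,a) ·_Φ ξ_B(k,b)). Then (H × G, ∗) admits a group factorization into the subgroups H × {e_G} and {e_H} × G (i.e. both subsets are subgroups of (H × G, ∗), their intersection is the identity element, and every element of H × G is the product of an element of H × {e_G} with an element of {e_H} × G) if and only if B is a relative Rota-Baxter operator on (G,·_G) with respect to Φ. -/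
theorem relativeRotaBaxter_map_one {G H : Type*} [Group G] [Group H]
    {Φ : G →* MulAut H} {B : H → G} (hB : ∀ h k : H, B h * B k = B (h * Φ (B h) k)) :
    B 1 = 1 := by
  simpa using hB 1 1

theorem relativeRotaBaxter_map_inv {G H : Type*} [Group G] [Group H]
    {Φ : G →* MulAut H} {B : H → G} (hB : ∀ h k : H, B h * B k = B (h * Φ (B h) k)) (h : H) :
    B (Φ (B h)⁻¹ h⁻¹) = (B h)⁻¹ := by
  refine eq_inv_of_mul_eq_one_right ?_
  rw [hB, map_inv Φ, MulAut.apply_inv_self, mul_inv_cancel, relativeRotaBaxter_map_one hB]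

/-- Let `Φ : G → Aut H` be an action and `B : H → G` any map. Let
`ξ_B : H × G → H ⋊[Φ] G`, `ξ_B (h, a) = (h, B h ·_G a)`, and let `∗` be the
group multiplication on `H × G` transported from the semidirect product along
`ξ_B`. Then `(H × G, ∗)` has a group factorization into `H × {e_G}` and
`{e_H} × G` if and only if `B` is a relative Rota-Baxter operator on `(G, ·_G)`
with respect to `Φ`. -/
theorem factorization_iff_relativeRotaBaxter {G H : Type*} [Group G] [Group H]
    (Φ : G →* MulAut H) (B : H → G) :
    let ξ : H × G → H ⋊[Φ] G := fun p => ⟨p.1, B p.1 * p.2⟩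
    let ξinv : H ⋊[Φ] G → H × G := fun q => (q.left, (B q.left)⁻¹ * q.right)
    let star : H × G → H × G → H × G := fun p q => ξinv (ξ p * ξ q)
    let pinv : H × G → H × G := fun p => ξinv (ξ p)⁻¹
    let e : H × G := ξinv 1
    let S1 : Set (H × G) := {p | p.2 = 1}
    let S2 : Set (H × G) := {p | p.1 = 1}
    ((e ∈ S1 ∧ (∀ p ∈ S1, ∀ q ∈ S1, star p q ∈ S1) ∧ (∀ p ∈ S1, pinv p ∈ S1)) ∧
     (e ∈ S2 ∧ (∀ p ∈ S2, ∀ q ∈ S2, star p q ∈ S2) ∧ (∀ p ∈ S2, pinv p ∈ S2)) ∧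
     S1 ∩ S2 = {e} ∧
     (∀ p : H × G, ∃ x ∈ S1, ∃ y ∈ S2, p = star x y)) ↔
    (∀ h k : H, B h * B k = B (h * Φ (B h) k)) := by
  intro ξ ξinv star pinv e S1 S2
  constructor
  · rintro ⟨⟨-, hmul, -⟩, -⟩ h k
    have hstar : (B (h * Φ (B h * 1) k))⁻¹ * (B h * 1 * (B k * 1)) = 1 :=
      hmul (h, 1) rfl (k, 1) rfl
    simpa only [mul_one] using (inv_mul_eq_one.mp hstar).symm
  · intro hB
    have hB1 : B 1 = 1 := relativeRotaBaxter_map_one hB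
    have he : e = (1, 1) := by simp [e, ξinv, hB1]
    refine ⟨⟨?_, ?_, ?_⟩, ⟨?_, ?_, ?_⟩, ?_, ?_⟩
    · simp [he, S1]
    · rintro ⟨h, _⟩ rfl ⟨k, _⟩ rfl
      simp [S1, star, ξ, ξinv, hB]
    · rintro ⟨h, _⟩ rfl
      have hinv := relativeRotaBaxter_map_inv hB h
      change (B (Φ (B h * 1)⁻¹ h⁻¹))⁻¹ * (B h * 1)⁻¹ = 1
      rw [mul_one, hinv, inv_mul_cancel]
    · simp [he, S2]
    · rintro ⟨_, a⟩ rfl ⟨_, b⟩ rfl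
      simp [S2, star, ξ, ξinv]
    · rintro ⟨_, a⟩ rfl
      simp [S2, pinv, ξ, ξinv]
    · ext ⟨h, a⟩
      simp [he, S1, S2, and_comm]
    · rintro ⟨h, a⟩
      refine ⟨(h, 1), rfl, (1, a), rfl, ?_⟩
      simp [star, ξ, ξinv, hB1]
end

section
/- Let (G,·_G) and (H,·_H) be groups, Φ : G → Aut(H) an action, and B : H → G a relative Rota-Baxter operator on (G,·_G) with respect to Φ. Define a ⇀ h = Φ(a)(h) and a ↼ h = B(Φ(a)(h))⁻¹ ·_G a ·_G B(h) for a ∈ G, h ∈ H. Then ((G,·_G), (H,∘_H), σ) is a matched pair of groups, where (H,∘_H) is the descendant group with h ∘_H k = h ·_H Φ(B(h))(k) and σ(a,h) = (a ⇀ h, a ↼ h). -/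
/-- A relative Rota-Baxter operator `B : H → G` on `(G, ·_G)` with
respect to an action `Φ` gives a matched pair of groups
`((G, ·_G), (H, ∘_H), σ)`, where `(H, ∘_H)` is the descendant group,
`a ⇀ h = Φ(a)(h)` and `a ↼ h = B(Φ(a)(h))⁻¹ ·_G a ·_G B(h)`. -/
theorem relativeRotaBaxter_matchedPair {G H : Type*} [Group G] [Group H]
    (Φ : G →* MulAut H) (B : H → G)
    (hB : ∀ h k : H, B h * B k = B (h * Φ (B h) k)) :
    let hr : G → H → H := fun a h => Φ a h
    let hl : G → H → G := fun a h => (B (Φ a h))⁻¹ * a * B h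
    let circ : H → H → H := fun h k => h * Φ (B h) k
    (∀ h : H, hr 1 h = h) ∧
    (∀ (a b : G) (h : H), hr a (hr b h) = hr (a * b) h) ∧
    (∀ (a b : G) (h : H), hl (a * b) h = hl a (hr b h) * hl b h) ∧
    (∀ a : G, hl a 1 = a) ∧
    (∀ (a : G) (h k : H), hl (hl a h) k = hl a (circ h k)) ∧
    (∀ (a : G) (h k : H), hr a (circ h k) = circ (hr a h) (hr (hl a h) k)) := by
  intro hr hl circ
  have map_one : B 1 = 1 := by simpa using hB 1 1
  have hr_circ (a : G) (h k : H) : hr a (circ h k) = circ (hr a h) (hr (hl a h) k) := by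
    simp [hr, hl, circ, MulAut.mul_apply]
  refine ⟨fun h => by simp [hr], fun a b h => by simp [hr], fun a b h => ?_,
    fun a => by simp [hl, map_one], fun a h k => ?_, hr_circ⟩
  · simp only [hl, hr, map_mul, MulAut.mul_apply]
    group
  · change (B (hr (hl a h) k))⁻¹ * ((B (hr a h))⁻¹ * a * B h) * B k =
      (B (hr a (circ h k)))⁻¹ * a * B (circ h k)
    rw [hr_circ, ← hB, ← hB]
    group
end

section
/- Let (G,·,▷) be a post-group with sub-adjacent group (G,∘), where a ∘ b = a·(a ▷ b), and let a† denote the inverse of a in (G,∘). Define R_G : G × G → G × G by R_G(a,b) = (a ▷ b, (a ▷ b)† ∘ a ∘ b). Then ((G,∘), R_G) is a braided group: (G,G,R_G) is a matched pair of groups with respect to the group structure (G,∘), and (a ▷ b) ∘ ((a ▷ b)† ∘ a ∘ b) = a ∘ b for all a,b ∈ G. -/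
/-- Let `(G, ·, ▷)` be a post-group with sub-adjacent group
`(G, ∘)`, `a ∘ b = a · (a ▷ b)`, and let `a†` be the inverse of `a` in
`(G, ∘)`. With `R_G (a, b) = (a ▷ b, (a ▷ b)† ∘ a ∘ b)`, the pair
`((G, ∘), R_G)` is a braided group: `(G, G, R_G)` is a matched pair of groups
for `(G, ∘)` and `(a ▷ b) ∘ ((a ▷ b)† ∘ a ∘ b) = a ∘ b`. -/
theorem postGroup_braidedGroup {G : Type*} [Group G] (tri : G → G → G)
    (hbij : ∀ a : G, Function.Bijective (tri a))
    (hdist : ∀ a b c : G, tri a (b * c) = tri a b * tri a c)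
    (hw : ∀ a b c : G, tri (a * tri a b) c = tri a (tri b c)) :
    let op : G → G → G := fun a b => a * tri a b
    let dag : G → G := fun a => (Equiv.ofBijective (tri a) (hbij a)).symm a⁻¹
    let hr : G → G → G := fun a b => tri a b
    let hl : G → G → G := fun a b => op (op (dag (tri a b)) a) b
    (∀ h : G, hr 1 h = h) ∧
    (∀ a b h : G, hr a (hr b h) = hr (op a b) h) ∧
    (∀ a b h : G, hl (op a b) h = op (hl a (hr b h)) (hl b h)) ∧
    (∀ a : G, hl a 1 = a) ∧
    (∀ a h k : G, hl (hl a h) k = hl a (op h k)) ∧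
    (∀ a h k : G, hr a (op h k) = op (hr a h) (hr (hl a h) k)) ∧
    (∀ a b : G, op (hr a b) (hl a b) = op a b) := by
  intro op dag hr hl
  have tri_one (a : G) : tri a 1 = 1 := by simpa using hdist a 1 1
  have one_tri (c : G) : tri 1 c = c :=
    (hbij 1).injective (by simpa [tri_one] using (hw 1 1 c).symm)
  have op_assoc (a b c : G) : op (op a b) c = op a (op b c) := by
    simp only [op, hw, hdist, mul_assoc]
  have op_left_cancel {a b c : G} (h : op a b = op a c) : b = c :=
    (hbij a).injective (mul_left_cancel h)
  have one_op (a : G) : op 1 a = a := by simp only [op, one_tri, one_mul]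
  have op_one (a : G) : op a 1 = a := by simp only [op, tri_one, mul_one]
  have op_dag (a : G) : op a (dag a) = 1 := by
    have h : tri a (dag a) = a⁻¹ := (Equiv.ofBijective (tri a) (hbij a)).apply_symm_apply a⁻¹
    simp only [op, h, mul_inv_cancel]
  have op_hr_hl (a b : G) : op (hr a b) (hl a b) = op a b := by
    change op (hr a b) (op (op (dag (hr a b)) a) b) = op a b
    rw [← op_assoc, ← op_assoc, op_dag, one_op]
  have hr_op_left (a b h : G) : hr a (hr b h) = hr (op a b) h := (hw a b h).symm
  have hr_op_right (a h k : G) : hr a (op h k) = op (hr a h) (hr (hl a h) k) := by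
    change tri a (h * tri h k) = hr a h * hr (hr a h) (hr (hl a h) k)
    rw [hr_op_left, op_hr_hl, ← hr_op_left, hdist]
  refine ⟨one_tri, hr_op_left, fun a b h => ?_, fun a => ?_, fun a h k => ?_, hr_op_right, op_hr_hl⟩
  · apply op_left_cancel (a := hr (op a b) h)
    rw [op_hr_hl, ← hr_op_left, ← op_assoc, op_hr_hl, op_assoc, op_assoc, op_hr_hl]
  · have h := op_hr_hl a 1
    rwa [show hr a 1 = 1 from tri_one a, one_op, op_one] at h
  · apply op_left_cancel (a := hr a (op h k))
    rw [op_hr_hl, hr_op_right, op_assoc, op_hr_hl, ← op_assoc, op_hr_hl, op_assoc]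
end

section
/- Let (G,·,▷) be a post-group with sub-adjacent group (G,∘), where a ∘ b = a·(a ▷ b), and let a† denote the inverse of a in (G,∘). Then the map R_G : G × G → G × G defined by R_G(a,b) = (a ▷ b, (a ▷ b)† ∘ a ∘ b) is a non-degenerate set-theoretic solution of the Yang-Baxter equation on the set G: R_G is bijective, satisfies (R_G × Id)(Id × R_G)(R_G × Id) = (Id × R_G)(R_G × Id)(Id × R_G), and, writing R_G(a,b) = (φ_a(b), ψ_b(a)), all maps φ_a and ψ_b are bijective. -/
/-- A left action `l` of a group on its underlying set which satisfies the matched-pair identity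
with respect to `r a b = (l a b)⁻¹ * a * b`, and for which `l a (a⁻¹ * p) = u` has a unique
solution `a`, gives a non-degenerate solution of the Yang-Baxter equation. -/
theorem yangBaxter_of_matched_action {H : Type*} [Group H] (l : H → H → H)
    (hl : ∀ a b c, l (a * b) c = l a (l b c))
    (hl_bij : ∀ a, Function.Bijective (l a))
    (hl_one : ∀ a, l a 1 = 1)
    (hl_mul : ∀ a b c, l a (b * c) = l a b * l ((l a b)⁻¹ * a * b) c)
    (h_solve : ∀ u p, ∃! a, l a (a⁻¹ * p) = u) :
    let R : H × H → H × H := fun p => (l p.1 p.2, (l p.1 p.2)⁻¹ * p.1 * p.2)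
    let R12 : H × H × H → H × H × H := fun p =>
      ((R (p.1, p.2.1)).1, (R (p.1, p.2.1)).2, p.2.2)
    let R23 : H × H × H → H × H × H := fun p => (p.1, R p.2)
    Function.Bijective R ∧
    (∀ p : H × H × H, R12 (R23 (R12 p)) = R23 (R12 (R23 p))) ∧
    (∀ a : H, Function.Bijective (fun b => (R (a, b)).1)) ∧
    (∀ b : H, Function.Bijective (fun a => (R (a, b)).2)) := by
  intro R R12 R23
  let r : H → H → H := fun a b => (l a b)⁻¹ * a * b
  have hc : ∀ a b, l a b * r a b = a * b := fun a b => by simp only [r]; group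
  have hr : ∀ a b c, r a (b * c) = r (r a b) c := fun a b c => by
    change (l a (b * c))⁻¹ * a * (b * c) = (l (r a b) c)⁻¹ * ((l a b)⁻¹ * a * b) * c
    rw [hl_mul]
    change (l a b * l (r a b) c)⁻¹ * a * (b * c) = _
    group
  have hr_one : ∀ a, r a 1 = a := fun a => by simp [r, hl_one]
  refine ⟨⟨?_, ?_⟩, ?_, hl_bij, fun b => ?_⟩
  · rintro ⟨a, b⟩ ⟨a', b'⟩ h
    obtain ⟨h1, h2⟩ : l a b = l a' b' ∧ r a b = r a' b' := Prod.ext_iff.mp h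
    have hp : a * b = a' * b' := by rw [← hc a b, ← hc a' b', h1, h2]
    have ha : a = a' := (h_solve (l a b) (a * b)).unique (by simp) (by rw [hp, h1]; simp)
    subst ha
    rw [mul_left_cancel hp]
  · rintro ⟨u, v⟩
    obtain ⟨a, ha, -⟩ := h_solve u (u * v)
    refine ⟨(a, a⁻¹ * (u * v)), ?_⟩
    simp only [R, ha]
    simp [mul_assoc]
  · rintro ⟨x, y, z⟩
    change (l (l x y) (l (r x y) z), r (l x y) (l (r x y) z), r (r x y) z) =
      (l x (l y z), l (r x (l y z)) (r y z), r (r x (l y z)) (r y z))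
    have h1 : l (l x y) (l (r x y) z) = l x (l y z) := by rw [← hl, hc, hl]
    have h3 : r (r x y) z = r (r x (l y z)) (r y z) := by rw [← hr, ← hr, hc]
    have hp : l (l x y) (l (r x y) z) * r (l x y) (l (r x y) z) * r (r x y) z =
        l x (l y z) * l (r x (l y z)) (r y z) * r (r x (l y z)) (r y z) := by
      rw [hc, mul_assoc, hc, ← mul_assoc, hc, mul_assoc (l x (l y z)), hc, ← mul_assoc, hc,
        mul_assoc x (l y z), hc, mul_assoc]
    rw [h1, h3] at hp
    rw [h1, h3, mul_left_cancel (mul_right_cancel hp)]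
  · refine Function.bijective_iff_has_inverse.mpr ⟨fun a => r a b⁻¹, fun a => ?_, fun a => ?_⟩
    · change r (r a b) b⁻¹ = a
      rw [← hr, mul_inv_cancel, hr_one]
    · change r (r a b⁻¹) b = a
      rw [← hr, inv_mul_cancel, hr_one]


/-- The group with a prescribed multiplication, unit and inverse. -/
abbrev groupOfOp {G : Type*} (op : G → G → G) (e : G) (inv : G → G)
    (h_assoc : ∀ a b c, op (op a b) c = op a (op b c)) (h_one_op : ∀ a, op e a = a)
    (h_inv_op : ∀ a, op (inv a) a = e) : Group G :=
  letI : Mul G := ⟨op⟩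
  letI : One G := ⟨e⟩
  letI : Inv G := ⟨inv⟩
  Group.ofLeftAxioms h_assoc h_one_op h_inv_op

/-- For a post-group `(G, ·, ▷)` with sub-adjacent group `(G, ∘)`
and sub-adjacent inverse `†`, the map
`R_G (a, b) = (a ▷ b, (a ▷ b)† ∘ a ∘ b)` is a non-degenerate set-theoretic
solution of the Yang-Baxter equation on the set `G`. -/
theorem postGroup_YangBaxter {G : Type*} [Group G] (tri : G → G → G)
    (hbij : ∀ a : G, Function.Bijective (tri a))
    (hdist : ∀ a b c : G, tri a (b * c) = tri a b * tri a c)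
    (hw : ∀ a b c : G, tri (a * tri a b) c = tri a (tri b c)) :
    let op : G → G → G := fun a b => a * tri a b
    let dag : G → G := fun a => (Equiv.ofBijective (tri a) (hbij a)).symm a⁻¹
    let R : G × G → G × G := fun p =>
      (tri p.1 p.2, op (op (dag (tri p.1 p.2)) p.1) p.2)
    let R12 : G × G × G → G × G × G := fun p =>
      ((R (p.1, p.2.1)).1, (R (p.1, p.2.1)).2, p.2.2)
    let R23 : G × G × G → G × G × G := fun p => (p.1, R p.2)
    Function.Bijective R ∧
    (∀ p : G × G × G, R12 (R23 (R12 p)) = R23 (R12 (R23 p))) ∧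
    (∀ a : G, Function.Bijective (fun b => (R (a, b)).1)) ∧
    (∀ b : G, Function.Bijective (fun a => (R (a, b)).2)) := by
  intro op dag
  have htri_one : ∀ a, tri a 1 = 1 := fun a => by
    simpa using hdist a 1 1
  have hone_tri : ∀ a, tri 1 a = a := fun a => by
    have h := hw 1 1 a
    rw [htri_one, mul_one] at h
    exact ((hbij 1).1 h).symm
  have htri_dag : ∀ a, tri a (dag a) = a⁻¹ := fun a =>
    (Equiv.ofBijective (tri a) (hbij a)).apply_symm_apply a⁻¹
  have hassoc : ∀ a b c, op (op a b) c = op a (op b c) := fun a b c => by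
    simp only [op, hw, hdist, mul_assoc]
  have hone_op : ∀ a, op 1 a = a := fun a => by simp [op, hone_tri]
  have hop_one : ∀ a, op a 1 = a := fun a => by simp [op, htri_one]
  have hop_dag : ∀ a, op a (dag a) = 1 := fun a => by simp [op, htri_dag]
  have hdag_op : ∀ a, op (dag a) a = 1 := fun a => by
    have h : op (dag a) (op a (op (dag a) (dag (dag a)))) = op (dag a) a := by
      rw [hop_dag, hop_one]
    rw [← h, ← hassoc a, hop_dag, hone_op, hop_dag]
  have hop_dag_op : ∀ a b, op a (op (dag a) b) = b := fun a b => by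
    rw [← hassoc, hop_dag, hone_op]
  have htri_op : ∀ a b c,
      tri a (op b c) = op (tri a b) (tri (op (op (dag (tri a b)) a) b) c) := fun a b c => by
    change tri a (b * tri b c) = tri a b * tri (tri a b) (tri (op (op (dag (tri a b)) a) b) c)
    rw [← hw (tri a b)]
    change _ = tri a b * tri (op (tri a b) (op (op (dag (tri a b)) a) b)) c
    rw [hassoc (dag _), hop_dag_op, hdist]
    exact congrArg _ (hw a b c).symm
  have hsolve : ∀ u p, ∃! a, tri a (op (dag a) p) = u := fun u p => by
    have key : ∀ a, a * tri a (op (dag a) p) = p := fun a => hop_dag_op a p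
    refine ⟨p * u⁻¹, ?_, fun a ha => ?_⟩
    · change tri (p * u⁻¹) (op (dag (p * u⁻¹)) p) = u
      rw [← mul_right_inj (p * u⁻¹), key, inv_mul_cancel_right]
    · change tri a (op (dag a) p) = u at ha
      rw [eq_mul_inv_iff_mul_eq, ← ha, key]
  exact @yangBaxter_of_matched_action G (groupOfOp op 1 dag hassoc hone_op hdag_op) tri hw hbij
    htri_one htri_op hsolve
end

section
/- Let Ψ : G → H be a homomorphism of post-groups from (G,·_G,▷_G) to (H,·_H,▷_H), i.e. Ψ(a ·_G b) = Ψ(a) ·_H Ψ(b) and Ψ(a ▷_G b) = Ψ(a) ▷_H Ψ(b) for all a,b ∈ G. Let R_G and R_H be the associated maps R_G(a,b) = (a ▷_G b, (a ▷_G b)† ∘_G a ∘_G b) and similarly for R_H, where ∘ is the sub-adjacent operation and † the sub-adjacent inverse. Then (Ψ × Ψ) ∘ R_G = R_H ∘ (Ψ × Ψ); that is, Ψ is a homomorphism of braided groups from ((G,∘_G),R_G) to ((H,∘_H),R_H). -/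
/-- A homomorphism `Ψ` of post-groups intertwines the associated
braidings: `(Ψ × Ψ) ∘ R_G = R_H ∘ (Ψ × Ψ)`; together with Theorem on
sub-adjacent groups, `Ψ` is a homomorphism of braided groups from
`((G, ∘_G), R_G)` to `((H, ∘_H), R_H)`. -/
theorem postGroupHom_braidedHom {G H : Type*} [Group G] [Group H]
    (triG : G → G → G) (triH : H → H → H)
    (hbijG : ∀ a : G, Function.Bijective (triG a))
    (hdistG : ∀ a b c : G, triG a (b * c) = triG a b * triG a c)
    (hwG : ∀ a b c : G, triG (a * triG a b) c = triG a (triG b c))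
    (hbijH : ∀ a : H, Function.Bijective (triH a))
    (hdistH : ∀ a b c : H, triH a (b * c) = triH a b * triH a c)
    (hwH : ∀ a b c : H, triH (a * triH a b) c = triH a (triH b c))
    (Ψ : G → H)
    (hmul : ∀ a b : G, Ψ (a * b) = Ψ a * Ψ b)
    (htri : ∀ a b : G, Ψ (triG a b) = triH (Ψ a) (Ψ b)) :
    let opG : G → G → G := fun a b => a * triG a b
    let dagG : G → G := fun a => (Equiv.ofBijective (triG a) (hbijG a)).symm a⁻¹
    let RG : G × G → G × G := fun p =>
      (triG p.1 p.2, opG (opG (dagG (triG p.1 p.2)) p.1) p.2)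
    let opH : H → H → H := fun a b => a * triH a b
    let dagH : H → H := fun a => (Equiv.ofBijective (triH a) (hbijH a)).symm a⁻¹
    let RH : H × H → H × H := fun p =>
      (triH p.1 p.2, opH (opH (dagH (triH p.1 p.2)) p.1) p.2)
    (∀ a b : G, Ψ (opG a b) = opH (Ψ a) (Ψ b)) ∧
    (∀ p : G × G, (Ψ (RG p).1, Ψ (RG p).2) = RH (Ψ p.1, Ψ p.2)) := by
  intro opG dagG RG opH dagH RH
  have hop (a b : G) : Ψ (opG a b) = opH (Ψ a) (Ψ b) := by
    simp only [opG, opH, hmul, htri]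
  have hinv (a : G) : Ψ a⁻¹ = (Ψ a)⁻¹ := map_inv (MonoidHom.mk' Ψ hmul) a
  have hdag (a : G) : Ψ (dagG a) = dagH (Ψ a) := by
    refine (Equiv.eq_symm_apply _).2 ?_
    rw [Equiv.ofBijective_apply, ← htri, ← hinv]
    exact congrArg Ψ ((Equiv.ofBijective (triG a) (hbijG a)).apply_symm_apply a⁻¹)
  refine ⟨hop, fun p => ?_⟩
  simp only [RG, RH, hop, hdag, htri]
end

section
/- Let (G,·_G) and (H,·_H) be groups, Φ : G → Aut(H) an action, and B : H → G a relative Rota-Baxter operator on (G,·_G) with respect to Φ. Let (H,∘_H) be the descendant group, h ∘_H k = h ·_H Φ(B(h))(k), and let h† denote the inverse of h in (H,∘_H). Then the map R_B : H × H → H × H defined by R_B(h,k) = (Φ(B(h))(k), (Φ(B(h))(k))† ∘_H h ∘_H k) is a set-theoretic solution of the Yang-Baxter equation on the set H. -/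
/-- The braiding map of the skew brace on `H` with lambda map `L`, written in terms of conjugation
by its first component. -/
def skewBraid {H : Type*} [Group H] (L : H → MulAut H) (p : H × H) : H × H :=
  (L p.1 p.2, (L (L p.1 p.2))⁻¹ ((L p.1 p.2)⁻¹ * p.1 * L p.1 p.2))

section SkewBraid

variable {H : Type*} [Group H] {L : H → MulAut H}

theorem skewBraid_bijective : Function.Bijective (skewBraid L) := by
  refine Function.bijective_iff_has_inverse.mpr
    ⟨fun q => (q.1 * L q.1 q.2 * q.1⁻¹, (L (q.1 * L q.1 q.2 * q.1⁻¹))⁻¹ q.1), ?_, ?_⟩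
  · rintro ⟨h, k⟩
    simp [skewBraid, mul_assoc]
  · rintro ⟨w, b⟩
    simp [skewBraid, mul_assoc]

/-- The two components of `skewBraid L (h, k)` act in succession as `h` and `k` do. -/
theorem apply_skewBraid (hL : ∀ h k, L (h * L h k) = L h * L k) (h k z : H) :
    L (skewBraid L (h, k)).1 (L (skewBraid L (h, k)).2 z) = L h (L k z) := by
  rw [← MulAut.mul_apply, ← MulAut.mul_apply, ← hL, ← hL]
  simp [skewBraid, mul_assoc]

/-- The second component of `skewBraid L` is determined by how its image under `L w` conjugates. -/
theorem inv_apply_conj (hL : ∀ h k, L (h * L h k) = L h * L k) (w v x : H) :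
    (L v)⁻¹ (v⁻¹ * (L w)⁻¹ x * v) =
      (L (w * L w v))⁻¹ ((L w v)⁻¹ * x * L w v) := by
  rw [hL, mul_inv_rev, MulAut.mul_apply]
  simp

theorem skewBraid_yangBaxter (hL : ∀ h k, L (h * L h k) = L h * L k) (x y z : H) :
    let a := skewBraid L (x, y)
    let b := skewBraid L (a.2, z)
    let c := skewBraid L (y, z)
    let d := skewBraid L (x, c.1)
    ((skewBraid L (a.1, b.1)).1, (skewBraid L (a.1, b.1)).2, b.2) = (d.1, skewBraid L (d.2, c.2)) := by
  intro a b c d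
  have hb : L a.1 b.1 = L x (L y z) := apply_skewBraid hL x y z
  have hd : d.1 = L x (L y z) := rfl
  have he : L d.1 (L d.2 c.2) = (L x (L y z))⁻¹ * L x y * L x (L y z) := by
    rw [apply_skewBraid hL x c.1 c.2]
    simp [c, skewBraid]
  refine Prod.ext hb (Prod.ext ?_ ?_)
  · change (L (L a.1 b.1))⁻¹ ((L a.1 b.1)⁻¹ * a.1 * L a.1 b.1) = L d.2 c.2
    rw [hb, MulAut.inv_apply, MulEquiv.symm_apply_eq, ← hd, he, hd]
    rfl
  · change (L b.1)⁻¹ (b.1⁻¹ * (L a.1)⁻¹ (a.1⁻¹ * x * a.1) * b.1) =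
      (L (L d.2 c.2))⁻¹ ((L d.2 c.2)⁻¹ * (L d.1)⁻¹ (d.1⁻¹ * x * d.1) * L d.2 c.2)
    rw [inv_apply_conj hL, inv_apply_conj hL, hb, he, hd]
    simp [a, skewBraid, mul_assoc]

end SkewBraid


/-- Let `B : H → G` be a relative Rota-Baxter operator on
`(G, ·_G)` with respect to an action `Φ`, with descendant group `(H, ∘_H)`,
`h ∘_H k = h ·_H Φ(B h)(k)`, and `h†` the inverse of `h` in `(H, ∘_H)`. Then
`R_B (h, k) = (Φ(B h)(k), (Φ(B h)(k))† ∘_H h ∘_H k)` is a set-theoretic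
solution of the Yang-Baxter equation on `H`. -/
theorem relativeRotaBaxter_YangBaxter {G H : Type*} [Group G] [Group H]
    (Φ : G →* MulAut H) (B : H → G)
    (hB : ∀ h k : H, B h * B k = B (h * Φ (B h) k)) :
    let circ : H → H → H := fun h k => h * Φ (B h) k
    let dag : H → H := fun h => (Φ (B h)).symm h⁻¹
    let R : H × H → H × H := fun p =>
      (Φ (B p.1) p.2, circ (circ (dag (Φ (B p.1) p.2)) p.1) p.2)
    let R12 : H × H × H → H × H × H := fun p =>
      ((R (p.1, p.2.1)).1, (R (p.1, p.2.1)).2, p.2.2)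
    let R23 : H × H × H → H × H × H := fun p => (p.1, R p.2)
    Function.Bijective R ∧
    (∀ p : H × H × H, R12 (R23 (R12 p)) = R23 (R12 (R23 p))) := by
  intro circ dag R R12 R23
  have hL : ∀ h k, Φ (B (h * Φ (B h) k)) = Φ (B h) * Φ (B k) := fun h k => by
    rw [← hB, map_mul]
  have hB_one : B 1 = 1 := by simpa using hB 1 1
  have hdag : ∀ w, Φ (B (dag w)) = (Φ (B w))⁻¹ := fun w => by
    refine (inv_eq_of_mul_eq_one_right ?_).symm
    rw [← hL]
    simp [dag, hB_one]
  have hR : R = skewBraid fun h => Φ (B h) := by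
    funext ⟨h, k⟩
    refine Prod.ext rfl ?_
    set w := Φ (B h) k with hw
    change dag w * Φ (B (dag w)) h * Φ (B (dag w * Φ (B (dag w)) h)) k =
      (Φ (B w))⁻¹ (w⁻¹ * h * w)
    rw [hL, hdag, MulAut.mul_apply, ← hw, map_mul, map_mul]
    rfl
  refine ⟨hR ▸ skewBraid_bijective, ?_⟩
  rintro ⟨x, y, z⟩
  simp only [R12, R23, hR]
  exact skewBraid_yangBaxter (L := fun h => Φ (B h)) hL x y z
end

section
/- Let (G,·,▷) be a pre-group, i.e. a post-group in which the group (G,·) is abelian, with sub-adjacent group (G,∘) (a ∘ b = a·(a ▷ b)) and a† the inverse of a in (G,∘). Then the map R_G(a,b) = (a ▷ b, (a ▷ b)† ∘ a ∘ b) is involutive: R_G ∘ R_G = Id on G × G. -/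
/-- In a post-group the neutral element acts as the identity. -/
theorem postGroup_one_tri {G : Type*} [Group G] {tri : G → G → G}
    (hinj : Function.Injective (tri 1))
    (hdist : ∀ b c : G, tri 1 (b * c) = tri 1 b * tri 1 c)
    (hw : ∀ a b c : G, tri (a * tri a b) c = tri a (tri b c)) (c : G) : tri 1 c = c := by
  have h1 : tri 1 1 = 1 := by simpa using hdist 1 1
  exact hinj (by simpa [h1] using (hw 1 1 c).symm)

/-- If `d` is the inverse of `y` for the sub-adjacent operation `∘`, then
`y ▷ (d ∘ z ∘ v) = y⁻¹ · z · (z ▷ v)`. -/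
theorem postGroup_tri_dag_op_op {G : Type*} [Group G] {tri : G → G → G}
    (hinj : Function.Injective (tri 1))
    (hdist : ∀ a b c : G, tri a (b * c) = tri a b * tri a c)
    (hw : ∀ a b c : G, tri (a * tri a b) c = tri a (tri b c))
    {y d : G} (hd : tri y d = y⁻¹) (z v : G) :
    tri y (d * tri d z * tri (d * tri d z) v) = y⁻¹ * z * tri z v := by
  have hcancel (c : G) : tri y (tri d c) = c := by
    rw [← hw, hd, mul_inv_cancel, postGroup_one_tri hinj (hdist 1) hw]
  rw [hw, hdist, hdist, hd, hcancel, hcancel]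

/-- For a pre-group `(G, ·, ▷)` (a post-group with `(G, ·)`
abelian), the braiding `R_G (a, b) = (a ▷ b, (a ▷ b)† ∘ a ∘ b)` is involutive:
`R_G ∘ R_G = Id` on `G × G`. -/
theorem preGroup_braiding_involutive {G : Type*} [CommGroup G] (tri : G → G → G)
    (hbij : ∀ a : G, Function.Bijective (tri a))
    (hdist : ∀ a b c : G, tri a (b * c) = tri a b * tri a c)
    (hw : ∀ a b c : G, tri (a * tri a b) c = tri a (tri b c)) :
    let op : G → G → G := fun a b => a * tri a b
    let dag : G → G := fun a => (Equiv.ofBijective (tri a) (hbij a)).symm a⁻¹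
    let R : G × G → G × G := fun p =>
      (tri p.1 p.2, op (op (dag (tri p.1 p.2)) p.1) p.2)
    ∀ p : G × G, R (R p) = p := by
  intro op dag R ⟨a, b⟩
  have hop (y z v : G) : tri y (op (op (dag y) z) v) = y⁻¹ * z * tri z v :=
    postGroup_tri_dag_op_op (hbij 1).injective hdist hw
      ((Equiv.ofBijective (tri y) (hbij y)).apply_symm_apply y⁻¹) z v
  have hfst : tri (tri a b) (op (op (dag (tri a b)) a) b) = a := by
    rw [hop, mul_right_comm, inv_mul_cancel, one_mul]
  refine Prod.ext hfst ((hbij a).injective ?_)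
  simp only [R]
  rw [hfst, hop, hfst, mul_right_comm, inv_mul_cancel, one_mul]
end

section
/- Let ((G,∘), R) be a braided group, and write R(a,b) = (a ⇀ b, a ↼ b). Define a ▷ b = a ⇀ b and a · b = a ∘ (a† ⇀ b), where a† is the inverse of a in (G,∘). Then (G,·,▷) is a post-group, and its sub-adjacent operation satisfies a·(a ▷ b) = a ∘ b for all a,b ∈ G. -/
/-- Let `((G, ∘), R)` be a braided group, `R (a, b) = (a ⇀ b, a ↼ b)`.
Then `a ▷ b = a ⇀ b` and `a · b = a ∘ (a† ⇀ b)` make `(G, ·, ▷)` a post-group,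
whose sub-adjacent operation `a · (a ▷ b)` equals `a ∘ b`. (Here `∘` is the
ambient group multiplication `*` and `a†` is `a⁻¹`.) -/
theorem braidedGroup_to_postGroup {G : Type*} [Group G]
    (hr : G → G → G) (hl : G → G → G)
    (mp1 : ∀ h : G, hr 1 h = h)
    (mp2 : ∀ a b h : G, hr a (hr b h) = hr (a * b) h)
    (mp3 : ∀ a b h : G, hl (a * b) h = hl a (hr b h) * hl b h)
    (mp4 : ∀ a : G, hl a 1 = a)
    (mp5 : ∀ a h k : G, hl (hl a h) k = hl a (h * k))
    (mp6 : ∀ a h k : G, hr a (h * k) = hr a h * hr (hl a h) k)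
    (hbraid : ∀ a b : G, hr a b * hl a b = a * b) :
    let tri : G → G → G := fun a b => hr a b
    let mul' : G → G → G := fun a b => a * hr a⁻¹ b
    (∀ a b c : G, mul' (mul' a b) c = mul' a (mul' b c)) ∧
    (∀ a : G, mul' a 1 = a) ∧
    (∀ a : G, mul' 1 a = a) ∧
    (∀ a : G, ∃ b : G, mul' a b = 1 ∧ mul' b a = 1) ∧
    (∀ a : G, Function.Bijective (tri a)) ∧
    (∀ a b c : G, tri a (mul' b c) = mul' (tri a b) (tri a c)) ∧
    (∀ a b c : G, tri (mul' a (tri a b)) c = tri a (tri b c)) ∧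
    (∀ a b : G, mul' a (tri a b) = a * b) := by
  intro tri mul'
  have tri_one (a : G) : hr a 1 = 1 := by
    have h := mp6 a 1 1
    rw [mp4, mul_one] at h
    exact left_eq_mul.mp h
  have tri_inv_tri (a b : G) : hr a⁻¹ (hr a b) = b := by
    rw [mp2, inv_mul_cancel, mp1]
  have tri_tri_inv (a b : G) : hr a (hr a⁻¹ b) = b := by
    rw [mp2, mul_inv_cancel, mp1]
  have mul_tri (a b : G) : mul' a (tri a b) = a * b := by
    simp only [mul', tri, tri_inv_tri]
  have tri_mul (a b c : G) : tri a (mul' b c) = mul' (tri a b) (tri a c) := by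
    have hl_mul_inv : hl a b * b⁻¹ = (hr a b)⁻¹ * a := by
      rw [eq_inv_mul_iff_mul_eq, ← mul_assoc, hbraid, mul_inv_cancel_right]
    simp only [mul', tri]
    rw [mp6, mp2, mp2, hl_mul_inv]
  have assoc (a b c : G) : mul' (mul' a b) c = mul' a (mul' b c) := by
    change _ = a * tri a⁻¹ (mul' b c)
    rw [tri_mul]
    simp only [mul', tri, mp2, mul_inv_rev, mul_assoc]
  have mul_one' (a : G) : mul' a 1 = a := by
    simp only [mul', tri_one, mul_one]
  have one_mul' (a : G) : mul' 1 a = a := by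
    simp only [mul', inv_one, mp1, one_mul]
  have right_inv (a : G) : mul' a (tri a a⁻¹) = 1 := by
    rw [mul_tri, mul_inv_cancel]
  refine ⟨assoc, mul_one', one_mul', fun a => ⟨tri a a⁻¹, right_inv a, ?_⟩, fun a => ?_,
    tri_mul, fun a b c => ?_, mul_tri⟩
  · obtain ⟨c, hc⟩ : ∃ c, mul' (tri a a⁻¹) c = 1 := ⟨_, right_inv _⟩
    have hac : a = c := by
      rw [← mul_one' a, ← hc, ← assoc, right_inv, one_mul']
    rwa [← hac] at hc
  · exact Function.bijective_iff_has_inverse.mpr ⟨hr a⁻¹, tri_inv_tri a, tri_tri_inv a⟩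
  · rw [mul_tri]
    exact (mp2 a b c).symm
end

section
/- Let (G,·,▷) be a post-group with sub-adjacent group (G,∘), where a ∘ b = a·(a ▷ b). Then (G,∘,·) is a skew-left brace: (G,∘) and (G,·) are groups on the same set and a ∘ (b·c) = (a ∘ b)·a⁻¹·(a ∘ c) for all a,b,c ∈ G, where a⁻¹ is the inverse of a in (G,·). Moreover, any homomorphism of post-groups Ψ : (G,·_G,▷_G) → (H,·_H,▷_H) is a homomorphism of the associated skew-left braces: Ψ(a ∘_G b) = Ψ(a) ∘_H Ψ(b) and Ψ(a ·_G b) = Ψ(a) ·_H Ψ(b). -/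
/-- STATEMENT 16: For a post-group `(G, ·, ▷)` with sub-adjacent operation
`a ∘ b = a · (a ▷ b)`, the triple `(G, ∘, ·)` is a skew-left brace: `(G, ∘)`
is a group on the same set as `(G, ·)` and
`a ∘ (b · c) = (a ∘ b) · a⁻¹ · (a ∘ c)`. Moreover, any homomorphism of
post-groups `Ψ` is a homomorphism of the associated skew-left braces. -/
theorem postGroup_skewLeftBrace {G H : Type*} [Group G] [Group H]
    (triG : G → G → G) (triH : H → H → H)
    (hbijG : ∀ a : G, Function.Bijective (triG a))
    (hdistG : ∀ a b c : G, triG a (b * c) = triG a b * triG a c)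
    (hwG : ∀ a b c : G, triG (a * triG a b) c = triG a (triG b c))
    (hbijH : ∀ a : H, Function.Bijective (triH a))
    (hdistH : ∀ a b c : H, triH a (b * c) = triH a b * triH a c)
    (hwH : ∀ a b c : H, triH (a * triH a b) c = triH a (triH b c))
    (Ψ : G → H)
    (hmul : ∀ a b : G, Ψ (a * b) = Ψ a * Ψ b)
    (htri : ∀ a b : G, Ψ (triG a b) = triH (Ψ a) (Ψ b)) :
    let opG : G → G → G := fun a b => a * triG a b
    let dagG : G → G := fun a => (Equiv.ofBijective (triG a) (hbijG a)).symm a⁻¹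
    let opH : H → H → H := fun a b => a * triH a b
    -- `(G, ∘)` is a group:
    ((∀ a b c : G, opG (opG a b) c = opG a (opG b c)) ∧
     (∀ a : G, opG a 1 = a) ∧ (∀ a : G, opG 1 a = a) ∧
     (∀ a : G, opG a (dagG a) = 1) ∧ (∀ a : G, opG (dagG a) a = 1)) ∧
    -- skew-left brace compatibility:
    (∀ a b c : G, opG a (b * c) = opG a b * a⁻¹ * opG a c) ∧
    -- `Ψ` is a homomorphism of skew-left braces:
    (∀ a b : G, Ψ (opG a b) = opH (Ψ a) (Ψ b)) ∧
    (∀ a b : G, Ψ (a * b) = Ψ a * Ψ b) := by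
  have triG_one : ∀ a : G, triG a 1 = 1 := fun a => by
    simpa using hdistG a 1 1
  have one_triG : ∀ c : G, triG 1 c = c := fun c => by
    have h := hwG 1 1 c
    rw [triG_one, mul_one] at h
    exact (hbijG 1).1 h.symm
  intro opG dagG opH
  have triG_dagG : ∀ a : G, triG a (dagG a) = a⁻¹ := fun a =>
    (Equiv.ofBijective (triG a) (hbijG a)).apply_symm_apply a⁻¹
  refine ⟨⟨fun a b c => ?_, fun a => ?_, fun a => ?_, fun a => ?_, fun a => ?_⟩,
    fun a b c => ?_, fun a b => ?_, hmul⟩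
  · simp only [opG, hwG, hdistG, mul_assoc]
  · simp only [opG, triG_one, mul_one]
  · simp only [opG, one_triG, one_mul]
  · simp only [opG, triG_dagG, mul_inv_cancel]
  · apply (hbijG a).1
    simp only [opG]
    rw [hdistG, ← hwG, triG_dagG, mul_inv_cancel, one_triG, inv_mul_cancel, triG_one]
  · simp only [opG, hdistG, mul_assoc, inv_mul_cancel_left]
  · simp only [opG, opH, hmul, htri]
end

section
/- Let (G,∘,·) be a skew-left brace. Define a ▷ b = a⁻¹·(a ∘ b), where a⁻¹ is the inverse of a in (G,·). Then (G,·,▷) is a post-group. Moreover, any homomorphism of skew-left braces Ψ : (G,∘_G,·_G) → (H,∘_H,·_H) (i.e. Ψ(a ∘_G b) = Ψ(a) ∘_H Ψ(b) and Ψ(a ·_G b) = Ψ(a) ·_H Ψ(b)) is a homomorphism of the associated post-groups: Ψ(a ▷_G b) = Ψ(a) ▷_H Ψ(b). -/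
/-- STATEMENT 17: For a skew-left brace `(G, ∘, ·)`, the operation
`a ▷ b = a⁻¹ · (a ∘ b)` makes `(G, ·, ▷)` a post-group. Moreover, any
homomorphism of skew-left braces is a homomorphism of the associated
post-groups. -/
theorem skewLeftBrace_to_postGroup {G H : Type*} [Group G] [Group H]
    (circG : G → G → G) (ecG : G) (cinvG : G → G)
    (hassocG : ∀ a b c : G, circG (circG a b) c = circG a (circG b c))
    (hid1G : ∀ a : G, circG a ecG = a) (hid2G : ∀ a : G, circG ecG a = a)
    (hinv1G : ∀ a : G, circG a (cinvG a) = ecG)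
    (hinv2G : ∀ a : G, circG (cinvG a) a = ecG)
    (hbraceG : ∀ a b c : G, circG a (b * c) = circG a b * a⁻¹ * circG a c)
    (circH : H → H → H) (ecH : H) (cinvH : H → H)
    (hassocH : ∀ a b c : H, circH (circH a b) c = circH a (circH b c))
    (hid1H : ∀ a : H, circH a ecH = a) (hid2H : ∀ a : H, circH ecH a = a)
    (hinv1H : ∀ a : H, circH a (cinvH a) = ecH)
    (hinv2H : ∀ a : H, circH (cinvH a) a = ecH)
    (hbraceH : ∀ a b c : H, circH a (b * c) = circH a b * a⁻¹ * circH a c)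
    (Ψ : G → H)
    (hcirc : ∀ a b : G, Ψ (circG a b) = circH (Ψ a) (Ψ b))
    (hmul : ∀ a b : G, Ψ (a * b) = Ψ a * Ψ b) :
    let triG : G → G → G := fun a b => a⁻¹ * circG a b
    let triH : H → H → H := fun a b => a⁻¹ * circH a b
    (∀ a : G, Function.Bijective (triG a)) ∧
    (∀ a b c : G, triG a (b * c) = triG a b * triG a c) ∧
    (∀ a b c : G, triG (a * triG a b) c = triG a (triG b c)) ∧
    (∀ a b : G, Ψ (triG a b) = triH (Ψ a) (Ψ b)) := by
  intro triG triH
  have htri_mul (a b c : G) : triG a (b * c) = triG a b * triG a c := by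
    simp only [triG, hbraceG, mul_assoc]
  have htri_inv (a b : G) : triG a b⁻¹ = (triG a b)⁻¹ :=
    map_inv (MonoidHom.mk' (triG a) (htri_mul a)) b
  refine ⟨fun a => ⟨fun b c h => ?_, fun c => ⟨circG (cinvG a) (a * c), ?_⟩⟩, htri_mul,
    fun a b c => ?_, fun a b => ?_⟩
  · have hcancel : circG a b = circG a c := mul_left_cancel h
    rw [← hid2G b, ← hinv2G a, hassocG, hcancel, ← hassocG, hinv2G, hid2G]
  · simp only [triG]
    rw [← hassocG, hinv1G, hid2G, inv_mul_cancel_left]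
  · change _ = triG a (b⁻¹ * circG b c)
    rw [htri_mul, htri_inv]
    simp only [triG, mul_inv_cancel_left, mul_inv_rev, inv_inv, hassocG, mul_assoc]
  · simp only [triG, triH, hmul, hcirc]
    rw [show Ψ a⁻¹ = (Ψ a)⁻¹ from map_inv (MonoidHom.mk' Ψ hmul) a]
end
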